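/- arXiv:2511.18994 — 3 statements merged into one kernel-verified Lean document; each statement's English description precedes it below -/
import Mathlib

section
/- For every integer l with 0 ≤ l ≤ A, the set C_l = {σ ⊆ {1,…,n} : Σ_{i∈σ} aⁱ₀ = l} is nonempty. -/
open Finset

/-- Strict lexicographic order on vectors of natural numbers. -/
def LexLt {k : ℕ} (x y : Fin k → ℕ) : Prop :=
  ∃ t, (∀ s, s < t → x s = y s) ∧ x t < y t

/-- If the positive values of a weight function on a finite set are closed downwards, then every
number up to the total weight is the weight of a subset. -/
theorem exists_subset_sum_eq_of_downward_closed {ι : Type*} [DecidableEq ι] (f : ι → ℕ)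
    (s : Finset ι) (hs : ∀ i ∈ s, ∀ k, 0 < k → k ≤ f i → ∃ j ∈ s, f j = k)
    (l : ℕ) (hl : l ≤ ∑ i ∈ s, f i) :
    ∃ σ ⊆ s, ∑ i ∈ σ, f i = l := by
  induction s using Finset.strongInduction generalizing l with
  | H s ih =>
    rcases Nat.eq_zero_or_pos l with rfl | hpos
    · exact ⟨∅, Finset.empty_subset s, Finset.sum_empty⟩
    have hne : s.Nonempty := by
      rw [Finset.nonempty_iff_ne_empty]
      rintro rfl
      rw [Finset.sum_empty] at hl
      omega
    obtain ⟨x, hx, hmax⟩ := s.exists_max_image f hne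
    rcases le_or_gt l (f x) with hlt | hge
    · obtain ⟨j, hj, rfl⟩ := hs x hx l hpos hlt
      exact ⟨{j}, Finset.singleton_subset_iff.2 hj, Finset.sum_singleton f j⟩
    have hsum := Finset.add_sum_erase s f hx
    obtain ⟨σ, hσ, hσl⟩ := ih (s.erase x) (Finset.erase_ssubset hx) (by
      intro i hi k hk hki
      obtain ⟨j, hj, hjk⟩ := hs i (Finset.mem_of_mem_erase hi) k hk hki
      by_cases hjx : j = x
      · subst hjx
        exact ⟨i, hi, le_antisymm (hjk ▸ hmax i (Finset.mem_of_mem_erase hi)) hki⟩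
      · exact ⟨j, Finset.mem_erase.2 ⟨hjx, hj⟩, hjk⟩) (l - f x) (by omega)
    have hxσ : x ∉ σ := fun h => Finset.notMem_erase x s (hσ h)
    refine ⟨insert x σ, Finset.insert_subset hx (hσ.trans (Finset.erase_subset x s)), ?_⟩
    rw [Finset.sum_insert hxσ, hσl]
    omega

/-- For every `0 ≤ l ≤ A = ∑_{i=1}^{n} aⁱ₀`, the set
`C_l = {σ ⊆ {1,…,n} : ∑_{i∈σ} aⁱ₀ = l}` is nonempty. -/
theorem C_l_nonempty
    (d : ℕ) (hd : 2 ≤ d)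
    (n : ℕ) (hn : n = (d + 2).choose 2)
    (a : ℕ → Fin 3 → ℕ)
    (ha_sum : ∀ i ∈ Finset.Icc 1 n, ∑ t, a i t = d)
    (ha_lex : ∀ i₁ ∈ Finset.Icc 1 n, ∀ i₂ ∈ Finset.Icc 1 n, i₁ < i₂ → LexLt (a i₁) (a i₂))
    (ha_surj : ∀ v : Fin 3 → ℕ, (∑ t, v t = d) → ∃ i ∈ Finset.Icc 1 n, a i = v)
    (l : ℕ) (hl : l ≤ ∑ i ∈ Finset.Icc 1 n, a i 0) :
    ∃ σ : Finset ℕ, σ ⊆ Finset.Icc 1 n ∧ ∑ i ∈ σ, a i 0 = l := by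
  refine exists_subset_sum_eq_of_downward_closed (fun i => a i 0) _ ?_ l hl
  intro i hi k _ hki
  have hid := ha_sum i hi
  rw [Fin.sum_univ_three] at hid
  obtain ⟨j, hj, hjv⟩ := ha_surj ![k, d - k, 0] (by
    simp only [Fin.sum_univ_three, Matrix.cons_val]
    omega)
  exact ⟨j, hj, by simp [hjv]⟩
end

section
/- For every integer l with 0 ≤ l ≤ A − 1, one has f_{l+1} ≥ f_l, where f_l = max_{σ∈C_l} Σ_{i∈σ} aⁱ₁. (In particular both maxima exist, since each C_l with 0 ≤ l ≤ A is nonempty.) -/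
open Finset

/-- The collection `C_l` of subsets `σ ⊆ {1,…,n}` with `∑_{i∈σ} aⁱ₀ = l`. -/
def Cset {k : ℕ} (n : ℕ) (a : ℕ → Fin (k+1) → ℕ) (l : ℕ) : Finset (Finset ℕ) :=
  (Finset.Icc 1 n).powerset.filter (fun σ => ∑ i ∈ σ, a i 0 = l)

/-- `f_l = max_{σ ∈ C_l} ∑_{i∈σ} aⁱ₁` (as a `Finset.sup`, which is the maximum
whenever `C_l` is nonempty). -/
def fval {k : ℕ} (n : ℕ) (a : ℕ → Fin (k+1) → ℕ) (l : ℕ) : ℕ :=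
  (Cset n a l).sup (fun σ => ∑ i ∈ σ, a i 1)

/-- If the index set realizes every vector of coordinate sum `d`, then a subset whose zeroth
coordinates do not add up to the total can be modified so that this sum grows by one and the sum of
first coordinates does not decrease. -/
lemma exists_subset_sum_succ {ι : Type*} [DecidableEq ι] (I : Finset ι) (d : ℕ)
    (a : ι → Fin 3 → ℕ) (ha_sum : ∀ i ∈ I, ∑ t, a i t = d)
    (ha_surj : ∀ v : Fin 3 → ℕ, (∑ t, v t = d) → ∃ i ∈ I, a i = v)
    (σ : Finset ι) (hσ : σ ⊆ I) (hlt : ∑ i ∈ σ, a i 0 < ∑ i ∈ I, a i 0) :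
    ∃ τ ⊆ I, ∑ i ∈ τ, a i 0 = ∑ i ∈ σ, a i 0 + 1 ∧ ∑ i ∈ σ, a i 1 ≤ ∑ i ∈ τ, a i 1 := by
  have hne : ((I \ σ).filter (fun i => 0 < a i 0)).Nonempty := by
    have hpos : 0 < ∑ i ∈ I \ σ, a i 0 := by
      have := Finset.sum_sdiff (f := fun i => a i 0) hσ
      omega
    obtain ⟨i, hi, hi0⟩ := Finset.exists_ne_zero_of_sum_ne_zero hpos.ne'
    exact ⟨i, Finset.mem_filter.2 ⟨hi, Nat.pos_of_ne_zero hi0⟩⟩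
  obtain ⟨i, hi, hmin⟩ := Finset.exists_min_image _ (fun i => a i 0) hne
  simp only [Finset.mem_filter, Finset.mem_sdiff] at hi hmin
  obtain ⟨⟨hiI, hiσ⟩, hi0⟩ := hi
  by_cases h1 : a i 0 = 1
  · refine ⟨insert i σ, Finset.insert_subset hiI hσ, ?_, ?_⟩ <;>
      rw [Finset.sum_insert hiσ] <;> omega
  · have hs := ha_sum i hiI
    obtain ⟨j, hjI, hj⟩ := ha_surj ![a i 0 - 1, a i 1, a i 2 + 1] (by
      simp [Fin.sum_univ_three] at hs ⊢
      omega)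
    have hj0 : a j 0 = a i 0 - 1 := by simp [hj]
    have hj1 : a j 1 = a i 1 := by simp [hj]
    have hjσ : j ∈ σ := by
      by_contra hjσ
      have := hmin j ⟨⟨hjI, hjσ⟩, by omega⟩
      omega
    have hie : i ∉ σ.erase j := fun h => hiσ (Finset.mem_of_mem_erase h)
    have e0 := Finset.add_sum_erase σ (fun i => a i 0) hjσ
    have e1 := Finset.add_sum_erase σ (fun i => a i 1) hjσ
    refine ⟨insert i (σ.erase j),
      Finset.insert_subset hiI ((Finset.erase_subset j σ).trans hσ), ?_, ?_⟩ <;>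
      rw [Finset.sum_insert hie] <;> omega

/-- For `0 ≤ l ≤ A - 1` one has `f_{l+1} ≥ f_l`; in particular both
maxima exist, since `C_l` and `C_{l+1}` are nonempty. -/
theorem f_monotone
    (d : ℕ) (hd : 2 ≤ d)
    (n : ℕ) (hn : n = (d + 2).choose 2)
    (a : ℕ → Fin 3 → ℕ)
    (ha_sum : ∀ i ∈ Finset.Icc 1 n, ∑ t, a i t = d)
    (ha_lex : ∀ i₁ ∈ Finset.Icc 1 n, ∀ i₂ ∈ Finset.Icc 1 n, i₁ < i₂ → LexLt (a i₁) (a i₂))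
    (ha_surj : ∀ v : Fin 3 → ℕ, (∑ t, v t = d) → ∃ i ∈ Finset.Icc 1 n, a i = v)
    (l : ℕ) (hl : l + 1 ≤ ∑ i ∈ Finset.Icc 1 n, a i 0) :
    (Cset n a l).Nonempty ∧ (Cset n a (l + 1)).Nonempty ∧ fval n a l ≤ fval n a (l + 1) := by
  have step : ∀ m, m + 1 ≤ ∑ i ∈ Finset.Icc 1 n, a i 0 → ∀ σ ∈ Cset n a m,
      ∃ τ ∈ Cset n a (m + 1), ∑ i ∈ σ, a i 1 ≤ ∑ i ∈ τ, a i 1 := by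
    intro m hm σ hσ
    simp only [Cset, Finset.mem_filter, Finset.mem_powerset] at hσ ⊢
    obtain ⟨τ, hτ, h0, h1⟩ := exists_subset_sum_succ (Finset.Icc 1 n) d a ha_sum ha_surj σ hσ.1
      (by omega)
    exact ⟨τ, ⟨hτ, by omega⟩, h1⟩
  have nonempty : ∀ m, m ≤ ∑ i ∈ Finset.Icc 1 n, a i 0 → (Cset n a m).Nonempty := by
    intro m
    induction m with
    | zero => exact fun _ => ⟨∅, by simp [Cset]⟩
    | succ m ih =>
      intro hm
      obtain ⟨σ, hσ⟩ := ih (by omega)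
      obtain ⟨τ, hτ, -⟩ := step m hm σ hσ
      exact ⟨τ, hτ⟩
  refine ⟨nonempty l (by omega), nonempty (l + 1) hl, Finset.sup_le fun σ hσ => ?_⟩
  obtain ⟨τ, hτ, h⟩ := step l hl σ hσ
  exact h.trans (Finset.le_sup (f := fun σ => ∑ i ∈ σ, a i 1) hτ)
end

section
/- Let 0 ≤ l ≤ A − 1 and let σ ∈ C_l be such that Σ_{i∈σ} aⁱ₁ = f_l. Then the set of indices corresponding to the elements (1,0,d−1), (2,0,d−2), …, (d,0,0) of 𝒜 is not contained in σ. -/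
open Finset

/-- Let `0 ≤ l ≤ A - 1` and let `σ ∈ C_l` attain `f_l`. Then the set of
indices corresponding to `(1,0,d-1), (2,0,d-2), …, (d,0,0)` is not contained in `σ`:
some `(k,0,d-k)` with `1 ≤ k ≤ d` has its index outside `σ`. -/
theorem claim_not_subset
    (d : ℕ) (hd : 2 ≤ d)
    (n : ℕ) (hn : n = (d + 2).choose 2)
    (a : ℕ → Fin 3 → ℕ)
    (ha_sum : ∀ i ∈ Finset.Icc 1 n, ∑ t, a i t = d)
    (ha_lex : ∀ i₁ ∈ Finset.Icc 1 n, ∀ i₂ ∈ Finset.Icc 1 n, i₁ < i₂ → LexLt (a i₁) (a i₂))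
    (ha_surj : ∀ v : Fin 3 → ℕ, (∑ t, v t = d) → ∃ i ∈ Finset.Icc 1 n, a i = v)
    (l : ℕ) (hl : l + 1 ≤ ∑ i ∈ Finset.Icc 1 n, a i 0)
    (σ : Finset ℕ) (hσ : σ ∈ Cset n a l) (hmax : ∑ i ∈ σ, a i 1 = fval n a l) :
    ∃ k : ℕ, 1 ≤ k ∧ k ≤ d ∧ ∃ i ∈ Finset.Icc 1 n, a i = ![k, 0, d - k] ∧ i ∉ σ := by
  obtain ⟨hsub, hsum⟩ := Finset.mem_filter.mp hσ
  rw [Finset.mem_powerset] at hsub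
  by_contra! hall
  obtain ⟨j, hjn, hjσ, hj0⟩ : ∃ j ∈ Finset.Icc 1 n, j ∉ σ ∧ 1 ≤ a j 0 := by
    by_contra! h
    have := Finset.sum_subset (f := fun i => a i 0) hsub
      (fun j hj hjσ => Nat.lt_one_iff.mp (h j hj hjσ))
    omega
  have hjd := ha_sum j hjn
  rw [Fin.sum_univ_three] at hjd
  obtain ⟨i, hin, hi⟩ := ha_surj ![a j 0, 0, d - a j 0] (by
    simp [Fin.sum_univ_three]
    omega)
  have hiσ : i ∈ σ := hall (a j 0) hj0 (by omega) i hin hi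
  have hi0 : a i 0 = a j 0 := by simp [hi]
  have hi1 : a i 1 = 0 := by simp [hi]
  have hj1 : 1 ≤ a j 1 := by
    by_contra! h
    refine hjσ (hall (a j 0) hj0 (by omega) j hjn ?_)
    ext t
    fin_cases t
    · simp
    · simpa using h
    · simp
      omega
  have hje : j ∉ σ.erase i := fun h => hjσ (Finset.mem_of_mem_erase h)
  have hmem : insert j (σ.erase i) ∈ Cset n a l := by
    refine Finset.mem_filter.mpr ⟨Finset.mem_powerset.mpr ?_, ?_⟩
    · exact Finset.insert_subset hjn ((Finset.erase_subset i σ).trans hsub)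
    · rw [Finset.sum_insert hje, ← hi0, Finset.add_sum_erase σ (fun i => a i 0) hiσ, hsum]
  have hle : ∑ i ∈ insert j (σ.erase i), a i 1 ≤ fval n a l :=
    Finset.le_sup (f := fun σ => ∑ i ∈ σ, a i 1) hmem
  have herase := Finset.add_sum_erase σ (fun i => a i 1) hiσ
  rw [Finset.sum_insert hje] at hle
  omega
end
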